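/- Let F_q be a finite field of odd characteristic, let n ≥ 18, let 0 < δ ≤ 1, let P ∈ F_q[x_0, …, x_{n−1}] have degree at most 2, let χ be a nontrivial additive character of F_q, and set Φ(f) = χ(P(x(f))) for f of degree < n. Suppose |∑_{f ∈ F_q[t], deg f < n} μ(f) Φ(f)| ≥ δ q^n. Then at least one of the following holds: (1) there is an integer k with 0 ≤ 9k ≤ n and a monic polynomial d of degree k such that the degree-≤-2 polynomial w ↦ P(x(dw)) on F_q^{n−k} (w ranging over polynomials of degree < n − k) has rank at most log_q(16 n⁵/δ²); or (2) there is an integer k with n ≤ 18k and 18k ≤ 17n such that for at least (δ⁴/(512 n^{10})) · q^{2k} pairs (d, d') of monic polynomials of degree k, the degree-≤-2 polynomial w ↦ P(x(dw)) − P(x(d'w)) on F_q^{n−k} has rank at most 2 log_q(512 n^{10}/δ⁴). -/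

import Mathlib

open Polynomial Matrix

/- The Möbius function on `F_q[t]`. -/
open scoped Classical in
noncomputable def polyMu {F : Type*} [Field F] (f : Polynomial F) : ℤ :=
  if Squarefree f then (-1) ^ (UniqueFactorizationMonoid.normalizedFactors f).card else 0

/-- The polynomial of degree `< n` with coefficient vector `x ∈ F_q^n`. -/
noncomputable def lowPoly (F : Type*) [Field F] (n : ℕ) (x : Fin n → F) : Polynomial F :=
  ∑ i : Fin n, C (x i) * X ^ (i : ℕ)

/-- The monic polynomial of degree `k` whose lower coefficient vector is `x ∈ F_q^k`. -/
noncomputable def monicPoly (F : Type*) [Field F] (k : ℕ) (x : Fin k → F) : Polynomial F :=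
  X ^ k + ∑ i : Fin k, C (x i) * X ^ (i : ℕ)

section

open scoped Classical

open UniqueFactorizationMonoid in
theorem normalizedFactors_finset_prod {F : Type*} [Field F] {g : F[X]} {T : Finset F[X]}
    (hT : ∀ p ∈ T, p ∈ normalizedFactors g) : normalizedFactors (∏ p ∈ T, p) = T.val := by
  have h := normalizedFactors_prod_eq T.val
    (fun p hp => irreducible_of_normalized_factor p (hT p hp))
  rw [Finset.prod_val] at h
  simp only [id] at h
  rw [h]
  conv_rhs => rw [← Multiset.map_id T.val]
  exact Multiset.map_congr rfl fun p hp => normalize_normalized_factor p (hT p hp)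

theorem monic_of_mem_normalizedFactors {F : Type*} [Field F] {g p : F[X]}
    (hp : p ∈ UniqueFactorizationMonoid.normalizedFactors g) : p.Monic := by
  rw [← UniqueFactorizationMonoid.normalize_normalized_factor p hp]
  exact monic_normalize (UniqueFactorizationMonoid.ne_zero_of_mem_normalizedFactors hp)

theorem prod_normalizedFactors_of_monic {F : Type*} [Field F] {d : F[X]} (hd : d.Monic) :
    (UniqueFactorizationMonoid.normalizedFactors d).prod = d := by
  refine Polynomial.eq_of_monic_of_associated ?_ hd
    (UniqueFactorizationMonoid.prod_normalizedFactors hd.ne_zero)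
  simpa using monic_multiset_prod_of_monic (UniqueFactorizationMonoid.normalizedFactors d) id
    fun p hp => monic_of_mem_normalizedFactors hp

open UniqueFactorizationMonoid in
theorem sum_polyMu_monic_divisors {F : Type*} [Field F] {g : F[X]} (hg : g ≠ 0)
    {S : Finset F[X]} (hS : ∀ d, d ∈ S ↔ d.Monic ∧ d ∣ g) :
    ∑ d ∈ S, polyMu d = if IsUnit g then 1 else 0 := by
  have hsum : ∑ T ∈ (normalizedFactors g).toFinset.powerset, (-1 : ℤ) ^ T.card =
      ∑ d ∈ S with Squarefree d, polyMu d := by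
    have hmem : ∀ T ∈ (normalizedFactors g).toFinset.powerset, ∀ p ∈ T,
        p ∈ normalizedFactors g := fun T hT p hp =>
      Multiset.mem_toFinset.1 (Finset.mem_powerset.1 hT hp)
    have hne : ∀ T ∈ (normalizedFactors g).toFinset.powerset, ∏ p ∈ T, p ≠ 0 := fun T hT =>
      Finset.prod_ne_zero_iff.2 fun p hp => ne_zero_of_mem_normalizedFactors (hmem T hT p hp)
    have hsq : ∀ T ∈ (normalizedFactors g).toFinset.powerset, Squarefree (∏ p ∈ T, p) :=
      fun T hT => by
        rw [squarefree_iff_nodup_normalizedFactors (hne T hT),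
          normalizedFactors_finset_prod (hmem T hT)]
        exact T.nodup
    refine Finset.sum_bij (fun T _ => ∏ p ∈ T, p) (fun T hT => ?_) (fun T hT U hU h => ?_)
      (fun d hd => ?_) (fun T hT => ?_)
    · refine Finset.mem_filter.2 ⟨(hS _).2
        ⟨monic_prod_of_monic _ _ fun p hp => monic_of_mem_normalizedFactors (hmem T hT p hp), ?_⟩,
        hsq T hT⟩
      rw [dvd_iff_normalizedFactors_le_normalizedFactors (hne T hT) hg,
        normalizedFactors_finset_prod (hmem T hT)]
      exact Multiset.le_iff_subset T.nodup |>.2 fun p hp => hmem T hT p hp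
    · apply Finset.val_injective
      rw [← normalizedFactors_finset_prod (hmem T hT), ← normalizedFactors_finset_prod (hmem U hU)]
      exact congrArg _ h
    · obtain ⟨hdS, hdq⟩ := Finset.mem_filter.1 hd
      obtain ⟨hdm, hdg⟩ := (hS d).1 hdS
      have hle := (dvd_iff_normalizedFactors_le_normalizedFactors hdm.ne_zero hg).1 hdg
      refine ⟨(normalizedFactors d).toFinset, Finset.mem_powerset.2 fun p hp =>
        Multiset.mem_toFinset.2 (Multiset.mem_of_le hle (Multiset.mem_toFinset.1 hp)), ?_⟩
      change ((normalizedFactors d).toFinset.val.map fun p => p).prod = d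
      rw [Multiset.toFinset_val, Multiset.dedup_eq_self.2
        ((squarefree_iff_nodup_normalizedFactors hdm.ne_zero).1 hdq), Multiset.map_id',
        prod_normalizedFactors_of_monic hdm]
    · rw [polyMu, if_pos (hsq T hT), normalizedFactors_finset_prod (hmem T hT)]
      rfl
  rw [Finset.sum_filter_of_ne fun d _ hd => by
    by_contra h; exact hd (if_neg h), Finset.sum_powerset_neg_one_pow_card] at hsum
  rw [← hsum]
  refine if_congr ?_ rfl rfl
  rw [Multiset.toFinset_eq_empty, normalizedFactors_eq_zero_iff hg]

theorem Associated.polyMu_eq {F : Type*} [Field F] {f g : F[X]} (h : Associated f g) :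
    polyMu f = polyMu g := by
  rw [polyMu, polyMu, h.squarefree_iff, h.normalizedFactors_eq]

theorem abs_polyMu_le_one {F : Type*} [Field F] (f : F[X]) : |polyMu f| ≤ 1 := by
  unfold polyMu
  split_ifs <;> simp [abs_pow]

theorem norm_polyMu_le_one {F : Type*} [Field F] (f : F[X]) : ‖(polyMu f : ℂ)‖ ≤ 1 := by
  rw [Complex.norm_intCast]
  exact_mod_cast abs_polyMu_le_one f

theorem coeff_lowPoly {F : Type*} [Field F] {n : ℕ} (x : Fin n → F) (j : ℕ) :
    (lowPoly F n x).coeff j = if h : j < n then x ⟨j, h⟩ else 0 := by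
  simp only [lowPoly, finsetSum_coeff, coeff_C_mul_X_pow]
  split_ifs with h
  · rw [Finset.sum_eq_single ⟨j, h⟩] <;> simp +contextual [Fin.ext_iff, eq_comm]
  · exact Finset.sum_eq_zero fun i _ => if_neg (by omega)

theorem degree_lowPoly_lt {F : Type*} [Field F] {n : ℕ} (x : Fin n → F) :
    (lowPoly F n x).degree < n := by
  rw [degree_lt_iff_coeff_zero]
  intro m hm
  rw [coeff_lowPoly, dif_neg (by omega)]

theorem lowPoly_injective {F : Type*} [Field F] (n : ℕ) :
    Function.Injective (lowPoly F n) := fun x y h => by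
  ext i
  simpa [coeff_lowPoly] using congrArg (fun f => f.coeff (i : ℕ)) h

theorem lowPoly_coeff {F : Type*} [Field F] {n : ℕ} {f : F[X]} (hf : f.degree < n) :
    lowPoly F n (fun i => f.coeff i) = f := by
  ext j
  rw [coeff_lowPoly]
  split_ifs with h
  · rfl
  · exact ((degree_lt_iff_coeff_zero _ _).1 hf j (by omega)).symm

theorem monicPoly_eq {F : Type*} [Field F] (k : ℕ) (x : Fin k → F) :
    monicPoly F k x = X ^ k + lowPoly F k x := rfl

theorem monicPoly_injective {F : Type*} [Field F] (k : ℕ) :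
    Function.Injective (monicPoly F k) := fun x y h => by
  rw [monicPoly_eq, monicPoly_eq] at h
  exact lowPoly_injective k (add_left_cancel h)

/-- The polynomials of degree `< n`. -/
noncomputable def lowSet (F : Type*) [Field F] [Fintype F] (n : ℕ) : Finset F[X] :=
  Finset.univ.image (lowPoly F n)

/-- The monic polynomials of degree `k`. -/
noncomputable def monSet (F : Type*) [Field F] [Fintype F] (k : ℕ) : Finset F[X] :=
  Finset.univ.image (monicPoly F k)

/-- The monic polynomials of degree in `[i, j)`. -/
noncomputable def monRange (F : Type*) [Field F] [Fintype F] (i j : ℕ) : Finset F[X] :=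
  (Finset.Ico i j).biUnion (monSet F)

section Finsets

variable {F : Type*} [Field F] [Fintype F]

theorem mem_lowSet {n : ℕ} {f : F[X]} : f ∈ lowSet F n ↔ f.degree < n := by
  simp only [lowSet, Finset.mem_image, Finset.mem_univ, true_and]
  exact ⟨fun ⟨x, hx⟩ => hx ▸ degree_lowPoly_lt x, fun h => ⟨_, lowPoly_coeff h⟩⟩

theorem mem_monSet {k : ℕ} {f : F[X]} : f ∈ monSet F k ↔ f.Monic ∧ f.natDegree = k := by
  simp only [monSet, Finset.mem_image, Finset.mem_univ, true_and, monicPoly_eq]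
  constructor
  · rintro ⟨x, rfl⟩
    have h := degree_lowPoly_lt x
    refine ⟨monic_X_pow_add h, natDegree_eq_of_degree_eq_some ?_⟩
    rw [degree_add_eq_left_of_degree_lt (by simpa using h), degree_X_pow]
  · rintro ⟨hm, rfl⟩
    refine ⟨fun i => (f - X ^ f.natDegree).coeff i, ?_⟩
    rw [lowPoly_coeff]
    · ring
    · have hd : f.degree = (X ^ f.natDegree : F[X]).degree := by
        rw [degree_X_pow, degree_eq_natDegree hm.ne_zero]
      have := degree_sub_lt_left hd hm.ne_zero (by simp [hm.leadingCoeff])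
      rwa [degree_eq_natDegree hm.ne_zero] at this

theorem mem_monRange {i j : ℕ} {f : F[X]} :
    f ∈ monRange F i j ↔ f.Monic ∧ i ≤ f.natDegree ∧ f.natDegree < j := by
  simp only [monRange, Finset.mem_biUnion, mem_monSet, Finset.mem_Ico]
  constructor
  · rintro ⟨k, hk, hf, rfl⟩
    exact ⟨hf, hk⟩
  · rintro ⟨hf, hk⟩
    exact ⟨_, hk, hf, rfl⟩

theorem sum_lowSet {M : Type*} [AddCommMonoid M] (n : ℕ) (g : F[X] → M) :
    ∑ f ∈ lowSet F n, g f = ∑ x : Fin n → F, g (lowPoly F n x) :=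
  Finset.sum_image fun _ _ _ _ h => lowPoly_injective n h

theorem sum_monSet {M : Type*} [AddCommMonoid M] (k : ℕ) (g : F[X] → M) :
    ∑ f ∈ monSet F k, g f = ∑ x : Fin k → F, g (monicPoly F k x) :=
  Finset.sum_image fun _ _ _ _ h => monicPoly_injective k h

theorem sum_monRange {M : Type*} [AddCommMonoid M] (i j : ℕ) (g : F[X] → M) :
    ∑ f ∈ monRange F i j, g f = ∑ k ∈ Finset.Ico i j, ∑ f ∈ monSet F k, g f := by
  refine Finset.sum_biUnion fun a _ b _ hab => Finset.disjoint_left.2 fun f hfa hfb => hab ?_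
  rw [← (mem_monSet.1 hfa).2, (mem_monSet.1 hfb).2]

theorem sum_monRange_consecutive {M : Type*} [AddCommMonoid M] {r n : ℕ} (h : r ≤ n)
    (g : F[X] → M) :
    ∑ f ∈ monRange F 0 r, g f + ∑ f ∈ monRange F r n, g f = ∑ f ∈ monRange F 0 n, g f := by
  simp only [sum_monRange]
  exact Finset.sum_Ico_consecutive _ (Nat.zero_le r) h

theorem card_lowSet (n : ℕ) : (lowSet F n).card = Fintype.card F ^ n := by
  rw [lowSet, Finset.card_image_of_injective _ (lowPoly_injective n)]
  simp

theorem card_monSet (k : ℕ) : (monSet F k).card = Fintype.card F ^ k := by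
  rw [monSet, Finset.card_image_of_injective _ (monicPoly_injective k)]
  simp

/-- The multiples of a monic polynomial `d` of degree `k` among the polynomials of degree `< n`
are the `d w` with `w` of degree `< n - k`. -/
theorem sum_lowSet_of_dvd {M : Type*} [AddCommMonoid M] {k n : ℕ} {d : F[X]}
    (hd : d ∈ monSet F k) {g : F[X] → M} (hg : ∀ f, ¬ d ∣ f → g f = 0) :
    ∑ f ∈ lowSet F n, g f = ∑ w ∈ lowSet F (n - k), g (d * w) := by
  obtain ⟨hm, rfl⟩ := mem_monSet.1 hd
  have hd0 := hm.ne_zero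
  rw [← Finset.sum_filter_of_ne (p := fun f => d ∣ f) fun f _ hf => by
    by_contra h; exact hf (hg f h)]
  symm
  refine Finset.sum_nbij (fun w => d * w) (fun w hw => ?_) (fun w _ w' _ h => ?_)
    (fun f hf => ?_) fun w _ => rfl
  · rw [Finset.mem_filter, mem_lowSet]
    refine ⟨?_, dvd_mul_right d w⟩
    rcases eq_or_ne w 0 with rfl | hw0
    · simp
    · rw [mem_lowSet, degree_eq_natDegree hw0, Nat.cast_lt] at hw
      rw [degree_eq_natDegree (mul_ne_zero hd0 hw0), natDegree_mul hd0 hw0, Nat.cast_lt]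
      omega
  · exact mul_left_cancel₀ hd0 h
  · obtain ⟨hf, w, rfl⟩ := Finset.mem_filter.1 hf
    refine ⟨w, ?_, rfl⟩
    rw [mem_lowSet] at hf
    rw [Finset.mem_coe, mem_lowSet]
    rcases eq_or_ne w 0 with rfl | hw0
    · simp
    · rw [degree_eq_natDegree (mul_ne_zero hd0 hw0), natDegree_mul hd0 hw0, Nat.cast_lt] at hf
      rw [degree_eq_natDegree hw0, Nat.cast_lt]
      omega

end Finsets

section Vaughan

variable {F : Type*} [Field F] [Fintype F]

theorem sum_polyMu_of_mul_dvd {n : ℕ} {a f : F[X]} (ha : a.Monic) (hf : f ∈ lowSet F n)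
    (hf0 : f ≠ 0) :
    ∑ b ∈ monRange F 0 n, (if a * b ∣ f then polyMu b else 0) =
      if Associated a f then 1 else 0 := by
  by_cases haf : a ∣ f
  · obtain ⟨g, rfl⟩ := haf
    have hg0 : g ≠ 0 := right_ne_zero_of_mul hf0
    rw [← Finset.sum_filter, sum_polyMu_monic_divisors hg0]
    · refine if_congr ⟨fun h => ?_, fun h => ?_⟩ rfl rfl
      · exact associated_mul_unit_right a g h
      · obtain ⟨u, hu⟩ := h
        rw [← mul_left_cancel₀ ha.ne_zero hu]
        exact u.isUnit
    · intro d
      rw [Finset.mem_filter, mem_monRange, mul_dvd_mul_iff_left ha.ne_zero]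
      refine ⟨fun h => ⟨h.1.1, h.2⟩, fun h => ⟨⟨h.1, Nat.zero_le _, ?_⟩, h.2⟩⟩
      rw [mem_lowSet, degree_eq_natDegree hf0, Nat.cast_lt] at hf
      refine lt_of_le_of_lt (natDegree_le_of_dvd ?_ hf0) hf
      exact h.2.trans (dvd_mul_left g a)
  · rw [if_neg fun h => haf h.dvd]
    exact Finset.sum_eq_zero fun b _ => if_neg fun h => haf ((dvd_mul_right a b).trans h)

theorem sum_polyMu_associated {f : F[X]} (r : ℕ) (hf0 : f ≠ 0) :
    ∑ a ∈ monRange F 0 r, (polyMu a * if Associated a f then 1 else 0) =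
      if f.natDegree < r then polyMu f else 0 := by
  have hass : Associated (normalize f) f := normalize_associated f
  have hmon : (normalize f).Monic := monic_normalize hf0
  have hdeg : (normalize f).natDegree = f.natDegree :=
    natDegree_eq_of_degree_eq (degree_eq_degree_of_associated hass)
  have huniq : ∀ a ∈ monRange F 0 r, a ≠ normalize f →
      (polyMu a * if Associated a f then 1 else 0) = 0 := fun a ha hne => by
    rw [if_neg fun h => hne ?_, mul_zero]
    exact eq_of_monic_of_associated (mem_monRange.1 ha).1 hmon (h.trans hass.symm)
  split_ifs with h
  · rw [Finset.sum_eq_single_of_mem _ (mem_monRange.2 ⟨hmon, Nat.zero_le _, hdeg ▸ h⟩) huniq,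
      if_pos hass, mul_one, hass.polyMu_eq]
  · refine Finset.sum_eq_zero fun a ha => huniq a ha ?_
    rintro rfl
    exact h (hdeg ▸ (mem_monRange.1 ha).2.2)

/-- The Vaughan identity, with both cutoffs equal to `r`. -/
theorem vaughan_identity {r n : ℕ} (hr : r ≤ n) {f : F[X]} (hf : f ∈ lowSet F n) (hf0 : f ≠ 0) :
    polyMu f =
      (∑ a ∈ monRange F r n, ∑ b ∈ monRange F r n,
        if a * b ∣ f then polyMu a * polyMu b else 0) -
      (∑ a ∈ monRange F 0 r, ∑ b ∈ monRange F 0 r,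
        if a * b ∣ f then polyMu a * polyMu b else 0) +
      2 * if f.natDegree < r then polyMu f else 0 := by
  have hnat : f.natDegree < n := by
    rwa [mem_lowSet, degree_eq_natDegree hf0, Nat.cast_lt] at hf
  have key : ∀ s, ∑ a ∈ monRange F 0 s, ∑ b ∈ monRange F 0 n,
      (if a * b ∣ f then polyMu a * polyMu b else 0) =
      if f.natDegree < s then polyMu f else 0 := fun s => by
    rw [← sum_polyMu_associated s hf0]
    refine Finset.sum_congr rfl fun a ha => ?_
    rw [← sum_polyMu_of_mul_dvd (mem_monRange.1 ha).1 hf hf0, Finset.mul_sum]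
    exact Finset.sum_congr rfl fun b _ => by rw [mul_ite, mul_zero]
  have key' : ∑ a ∈ monRange F 0 n, ∑ b ∈ monRange F 0 r,
      (if a * b ∣ f then polyMu a * polyMu b else 0) =
      if f.natDegree < r then polyMu f else 0 := by
    rw [← key r, Finset.sum_comm]
    refine Finset.sum_congr rfl fun a _ => Finset.sum_congr rfl fun b _ => ?_
    rw [mul_comm b a, mul_comm (polyMu b)]
  have h1 := key n
  have h2 := key r
  rw [if_pos hnat, ← sum_monRange_consecutive hr] at h1
  rw [← sum_monRange_consecutive hr] at key'
  simp only [← sum_monRange_consecutive hr (fun b => if _ * b ∣ f then _ * polyMu b else 0),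
    Finset.sum_add_distrib] at h1 h2
  linarith

end Vaughan

theorem card_filter_add_le (m : ℕ) :
    ((Finset.range m ×ˢ Finset.range m ×ˢ Finset.range m).filter
      fun t => t.1 + t.2.1 + t.2.2 ≤ m).card ≤ m ^ 3 := by
  refine (Finset.card_filter_le _ _).trans ?_
  simp only [Finset.card_product, Finset.card_range]
  exact (by ring : m * (m * m) = m ^ 3).le

/-- Two monic divisors of `w` have the form `g d`, `g e` with `w = g d e h`. -/
theorem exists_common_factorization {F : Type*} [Field F] {a b w : F[X]} (ha : a.Monic) (hb : b.Monic)
    (haw : a ∣ w) (hbw : b ∣ w) :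
    ∃ g d e h : F[X], g.Monic ∧ d.Monic ∧ e.Monic ∧ a = g * d ∧ b = g * e ∧
      w = g * d * e * h := by
  have hg0 : EuclideanDomain.gcd a b ≠ 0 := fun h =>
    ha.ne_zero (EuclideanDomain.gcd_eq_zero_iff.1 h).1
  have hgm : (normalize (EuclideanDomain.gcd a b)).Monic := monic_normalize hg0
  have hass := normalize_associated (EuclideanDomain.gcd a b)
  obtain ⟨d, hd⟩ := hass.dvd.trans (EuclideanDomain.gcd_dvd_left a b)
  obtain ⟨e, he⟩ := hass.dvd.trans (EuclideanDomain.gcd_dvd_right a b)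
  set g := normalize (EuclideanDomain.gcd a b) with hg
  have hco : IsCoprime d e := by
    obtain ⟨x, y, hxy⟩ : ∃ x y, a * x + b * y = g := by
      obtain ⟨u, hu⟩ := hass.symm
      refine ⟨EuclideanDomain.gcdA a b * u, EuclideanDomain.gcdB a b * u, ?_⟩
      rw [← hu]
      conv_rhs => rw [EuclideanDomain.gcd_eq_gcd_ab a b]
      ring
    refine ⟨x, y, mul_left_cancel₀ hgm.ne_zero ?_⟩
    rw [mul_one]
    conv_rhs => rw [← hxy, hd, he]
    ring
  obtain ⟨w', rfl⟩ := haw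
  have hew : e ∣ w' := by
    refine hco.symm.dvd_of_dvd_mul_left ?_
    rw [hd, he, mul_assoc] at hbw
    exact (mul_dvd_mul_iff_left hgm.ne_zero).1 hbw
  obtain ⟨h, rfl⟩ := hew
  refine ⟨g, d, e, h, hgm, ?_, ?_, hd, he, by rw [hd]; ring⟩
  · exact hgm.of_mul_monic_left (hd ▸ ha)
  · exact hgm.of_mul_monic_left (he ▸ hb)

section DivisorMoment

variable {F : Type*} [Field F] [Fintype F]

/-- The second moment of the number of monic divisors of a nonzero polynomial of
degree `< m`. -/
theorem sum_sq_card_divisors_le (m j : ℕ) :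
    ∑ w ∈ (lowSet F m).erase 0, ((monRange F 0 j).filter (· ∣ w)).card ^ 2 ≤
      m ^ 3 * Fintype.card F ^ m := by
  let U : Finset (Σ _ : F[X], F[X] × F[X]) := ((lowSet F m).erase 0).sigma fun w =>
    (monRange F 0 j).filter (· ∣ w) ×ˢ (monRange F 0 j).filter (· ∣ w)
  let I := (Finset.range m ×ˢ Finset.range m ×ˢ Finset.range m).filter
    fun t => t.1 + t.2.1 + t.2.2 ≤ m
  let D : ℕ × ℕ × ℕ → Finset (F[X] × F[X] × F[X] × F[X]) := fun t =>
    monSet F t.1 ×ˢ monSet F t.2.1 ×ˢ monSet F t.2.2 ×ˢ lowSet F (m - (t.1 + t.2.1 + t.2.2))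
  let φ : F[X] × F[X] × F[X] × F[X] → Σ _ : F[X], F[X] × F[X] := fun s =>
    ⟨s.1 * s.2.1 * s.2.2.1 * s.2.2.2, s.1 * s.2.1, s.1 * s.2.2.1⟩
  have hU : ∑ w ∈ (lowSet F m).erase 0, ((monRange F 0 j).filter (· ∣ w)).card ^ 2 = U.card := by
    rw [Finset.card_sigma]
    exact Finset.sum_congr rfl fun w _ => by rw [Finset.card_product, sq]
  have hsub : U ⊆ I.biUnion fun t => (D t).image φ := by
    rintro ⟨w, a, b⟩ hx
    obtain ⟨hw, hab⟩ := Finset.mem_sigma.1 hx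
    obtain ⟨hw0, hw⟩ := Finset.mem_erase.1 hw
    obtain ⟨ha, hb⟩ := Finset.mem_product.1 hab
    obtain ⟨ha, haw⟩ := Finset.mem_filter.1 ha
    obtain ⟨hb, hbw⟩ := Finset.mem_filter.1 hb
    obtain ⟨g, d, e, h, hg, hd, he, rfl, rfl, rfl⟩ := exists_common_factorization
      (mem_monRange.1 ha).1 (mem_monRange.1 hb).1 haw hbw
    have hh0 : h ≠ 0 := right_ne_zero_of_mul hw0
    have hgd0 := mul_ne_zero hg.ne_zero hd.ne_zero
    dsimp only at hw hw0
    rw [mem_lowSet, degree_eq_natDegree hw0, Nat.cast_lt,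
      natDegree_mul (mul_ne_zero hgd0 he.ne_zero) hh0, natDegree_mul hgd0 he.ne_zero,
      natDegree_mul hg.ne_zero hd.ne_zero] at hw
    refine Finset.mem_biUnion.2 ⟨(g.natDegree, d.natDegree, e.natDegree), ?_,
      Finset.mem_image.2 ⟨(g, d, e, h), ?_, rfl⟩⟩
    · simp only [I, Finset.mem_filter, Finset.mem_product, Finset.mem_range]
      omega
    · simp only [D, Finset.mem_product, mem_monSet, mem_lowSet, hg, hd, he, true_and]
      rw [degree_eq_natDegree hh0, Nat.cast_lt]
      omega
  rw [hU]
  calc U.card ≤ ∑ t ∈ I, ((D t).image φ).card :=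
        (Finset.card_le_card hsub).trans Finset.card_biUnion_le
    _ ≤ ∑ t ∈ I, Fintype.card F ^ m := by
        refine Finset.sum_le_sum fun t ht => Finset.card_image_le.trans (le_of_eq ?_)
        have h := (Finset.mem_filter.1 ht).2
        simp only [D, Finset.card_product, card_monSet, card_lowSet, ← pow_add]
        congr 1
        omega
    _ ≤ m ^ 3 * Fintype.card F ^ m := by
        rw [Finset.sum_const, smul_eq_mul]
        exact Nat.mul_le_mul_right _ (card_filter_add_le m)

end DivisorMoment

section QuadraticPhases

variable {F : Type*} [Field F]

/-- `g` is a polynomial function of degree at most two, with symmetric quadratic part `M`. -/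
def HasQuadForm {m : ℕ} (g : (Fin m → F) → F) (M : Matrix (Fin m) (Fin m) F) : Prop :=
  Mᵀ = M ∧ ∃ (b : Fin m → F) (c : F), ∀ y, g y = y ⬝ᵥ M.mulVec y + b ⬝ᵥ y + c

theorem HasQuadForm.add {m : ℕ} {g g' : (Fin m → F) → F} {M M' : Matrix (Fin m) (Fin m) F}
    (h : HasQuadForm g M) (h' : HasQuadForm g' M') :
    HasQuadForm (fun y => g y + g' y) (M + M') := by
  obtain ⟨hM, b, c, hg⟩ := h
  obtain ⟨hM', b', c', hg'⟩ := h'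
  refine ⟨by rw [transpose_add, hM, hM'], b + b', c + c', fun y => ?_⟩
  simp only [hg, hg']
  rw [add_mulVec, dotProduct_add, add_dotProduct]
  ring

theorem HasQuadForm.const_mul {m : ℕ} {g : (Fin m → F) → F} {M : Matrix (Fin m) (Fin m) F}
    (h : HasQuadForm g M) (r : F) : HasQuadForm (fun y => r * g y) (r • M) := by
  obtain ⟨hM, b, c, hg⟩ := h
  refine ⟨by rw [transpose_smul, hM], r • b, r * c, fun y => ?_⟩
  simp only [hg]
  rw [smul_mulVec, dotProduct_smul, smul_dotProduct, smul_eq_mul, smul_eq_mul]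
  ring

theorem HasQuadForm.sub {m : ℕ} {g g' : (Fin m → F) → F} {M M' : Matrix (Fin m) (Fin m) F}
    (h : HasQuadForm g M) (h' : HasQuadForm g' M') :
    HasQuadForm (fun y => g y - g' y) (M + (-1 : F) • M') := by
  convert h.add (h'.const_mul (-1)) using 2
  ring

theorem HasQuadForm.affine {m : ℕ} (b : Fin m → F) (c : F) :
    HasQuadForm (fun y => b ⬝ᵥ y + c) 0 :=
  ⟨transpose_zero, b, c, fun y => by simp⟩

theorem HasQuadForm.mul_linear {m : ℕ} (h2 : (2 : F) ≠ 0) (b b' : Fin m → F) :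
    HasQuadForm (fun y => (b ⬝ᵥ y) * (b' ⬝ᵥ y))
      ((2 : F)⁻¹ • (vecMulVec b b' + vecMulVec b' b)) := by
  refine ⟨?_, 0, 0, fun y => ?_⟩
  · rw [transpose_smul, transpose_add, transpose_vecMulVec, transpose_vecMulVec, add_comm]
  · rw [smul_mulVec, add_mulVec, vecMulVec_mulVec, vecMulVec_mulVec, dotProduct_smul,
      dotProduct_add]
    simp only [op_smul_eq_smul, dotProduct_smul, smul_eq_mul, dotProduct_comm y b,
      dotProduct_comm y b', zero_dotProduct, add_zero]
    field_simp
    ring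

theorem HasQuadForm.exists_sum {ι : Type*} {m : ℕ} (s : Finset ι) {g : ι → (Fin m → F) → F}
    (h : ∀ i ∈ s, ∃ M, HasQuadForm (g i) M) : ∃ M, HasQuadForm (fun y => ∑ i ∈ s, g i y) M := by
  induction s using Finset.induction_on with
  | empty => exact ⟨0, by simpa using HasQuadForm.affine (0 : Fin m → F) 0⟩
  | insert i s hi ih =>
    obtain ⟨M, hM⟩ := h i (Finset.mem_insert_self i s)
    obtain ⟨N, hN⟩ := ih fun j hj => h j (Finset.mem_insert_of_mem hj)
    exact ⟨M + N, by simpa only [Finset.sum_insert hi] using hM.add hN⟩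

/-- A polynomial of degree at most two, composed with linear forms, is a quadratic function. -/
theorem MvPolynomial.exists_hasQuadForm {m n : ℕ} (h2 : (2 : F) ≠ 0) {P : MvPolynomial (Fin n) F}
    (hP : P.totalDegree ≤ 2) (L : Fin n → Fin m → F) :
    ∃ M, HasQuadForm (fun y => MvPolynomial.eval (fun i => L i ⬝ᵥ y) P) M := by
  simp only [MvPolynomial.eval_eq]
  refine HasQuadForm.exists_sum _ fun s hs => ?_
  suffices h : ∃ M, HasQuadForm (fun y => ∏ i ∈ s.support, (L i ⬝ᵥ y) ^ s i) M by
    obtain ⟨M, hM⟩ := h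
    exact ⟨_, hM.const_mul (P.coeff s)⟩
  have hprod : ∀ y, ∏ i ∈ s.support, (L i ⬝ᵥ y) ^ s i =
      ((Finsupp.toMultiset s).map fun i => L i ⬝ᵥ y).prod := fun y => by
    rw [Finsupp.toMultiset_map, Finsupp.prod_toMultiset,
      Finsupp.prod_mapDomain_index (by simp) (by simp [pow_add])]
    rfl
  have hcard : (Finsupp.toMultiset s).card ≤ 2 := by
    rw [Finsupp.card_toMultiset]
    exact (MvPolynomial.le_totalDegree hs).trans hP
  simp only [hprod]
  interval_cases hc : (Finsupp.toMultiset s).card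
  · rw [Multiset.card_eq_zero.1 hc]
    exact ⟨0, by simpa using HasQuadForm.affine (0 : Fin m → F) 1⟩
  · obtain ⟨i, hi⟩ := Multiset.card_eq_one.1 hc
    rw [hi]
    exact ⟨0, by simpa using HasQuadForm.affine (L i) 0⟩
  · obtain ⟨i, j, hij⟩ := Multiset.card_eq_two.1 hc
    rw [hij]
    exact ⟨_, by simpa using HasQuadForm.mul_linear h2 (L i) (L j)⟩

theorem coeff_mul_lowPoly (d : F[X]) {m : ℕ} (y : Fin m → F) (i : ℕ) :
    (d * lowPoly F m y).coeff i =
      (fun j : Fin m => (d * X ^ (j : ℕ)).coeff i) ⬝ᵥ y := by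
  rw [lowPoly, Finset.mul_sum, finsetSum_coeff, dotProduct]
  refine Finset.sum_congr rfl fun j _ => ?_
  rw [mul_left_comm, coeff_C_mul, mul_comm]

theorem exists_hasQuadForm_mul_lowPoly {n : ℕ} (h2 : (2 : F) ≠ 0) {P : MvPolynomial (Fin n) F}
    (hP : P.totalDegree ≤ 2) (d : F[X]) (m : ℕ) :
    ∃ M, HasQuadForm (fun y : Fin m → F =>
      MvPolynomial.eval (fun i : Fin n => (d * lowPoly F m y).coeff (i : ℕ)) P) M := by
  simp only [coeff_mul_lowPoly]
  exact P.exists_hasQuadForm h2 hP _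

variable [Fintype F]

theorem sum_addChar_dotProduct {χ : AddChar F Circle} (hχ : χ ≠ 1) {m : ℕ} (v : Fin m → F) :
    ∑ y : Fin m → F, (χ (v ⬝ᵥ y) : ℂ) = if v = 0 then (Fintype.card F : ℂ) ^ m else 0 := by
  split_ifs with hv
  · simp [hv]
  · let ψ : AddChar (Fin m → F) ℂ :=
      { toFun := fun y => (χ (v ⬝ᵥ y) : ℂ)
        map_zero_eq_one' := by simp
        map_add_eq_mul' := fun y z => by simp [dotProduct_add, AddChar.map_add_eq_mul] }
    change ∑ y, ψ y = 0
    rw [AddChar.sum_eq_zero_iff_ne_zero]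
    intro h
    apply hχ
    obtain ⟨i, hi⟩ := Function.ne_iff.1 hv
    ext t
    have := congrArg (fun ψ : AddChar (Fin m → F) ℂ => ψ (Pi.single i ((v i)⁻¹ * t))) h
    have hi' : v i ≠ 0 := hi
    simpa [ψ, hi', dotProduct_single] using this

theorem card_ker_mulVec {m : ℕ} (M : Matrix (Fin m) (Fin m) F) :
    (Finset.univ.filter fun h : Fin m → F => M.mulVec h = 0).card =
      Fintype.card F ^ (m - M.rank) := by
  have h1 := M.mulVecLin.finrank_range_add_finrank_ker
  rw [Module.finrank_fin_fun] at h1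
  have h2 : Module.finrank F (LinearMap.ker M.mulVecLin) = m - M.rank := by
    rw [Matrix.rank]; omega
  rw [← h2, ← Module.card_eq_pow_finrank (V := LinearMap.ker M.mulVecLin),
    ← Fintype.card_coe]
  exact Fintype.card_congr (Equiv.subtypeEquivRight fun h => by simp)

/-- The Gauss sum bound. -/
theorem norm_sq_sum_addChar_le (h2 : (2 : F) ≠ 0) {χ : AddChar F Circle} (hχ : χ ≠ 1) {m : ℕ}
    {g : (Fin m → F) → F} {M : Matrix (Fin m) (Fin m) F} (hg : HasQuadForm g M) :
    ‖∑ y, (χ (g y) : ℂ)‖ ^ 2 ≤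
      (Fintype.card F : ℝ) ^ m * (Fintype.card F : ℝ) ^ (m - M.rank) := by
  obtain ⟨hM, b, c, hg⟩ := hg
  have hdiff : ∀ h y, g (h + y) - g y =
      (h ⬝ᵥ M.mulVec h + b ⬝ᵥ h) + ((2 : F) • M.mulVec h) ⬝ᵥ y := fun h y => by
    have hsymm : y ⬝ᵥ M.mulVec h = h ⬝ᵥ M.mulVec y := by
      rw [dotProduct_mulVec, ← mulVec_transpose, hM, dotProduct_comm]
    rw [hg, hg, mulVec_add, dotProduct_add, add_dotProduct, add_dotProduct, dotProduct_add,
      smul_dotProduct, dotProduct_comm (M.mulVec h) y, hsymm, smul_eq_mul]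
    ring
  have hsq : ((‖∑ y, (χ (g y) : ℂ)‖ ^ 2 : ℝ) : ℂ) =
      ∑ h : Fin m → F, (χ (h ⬝ᵥ M.mulVec h + b ⬝ᵥ h) : ℂ) *
        ∑ y : Fin m → F, (χ (((2 : F) • M.mulVec h) ⬝ᵥ y) : ℂ) := by
    rw [Complex.ofReal_pow, ← Complex.mul_conj', map_sum, Finset.sum_mul_sum, Finset.sum_comm]
    have : ∀ y : Fin m → F, ∑ x, (χ (g x) : ℂ) * (starRingEnd ℂ) (χ (g y) : ℂ) =
        ∑ h, (χ (g (h + y) - g y) : ℂ) := fun y => by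
      rw [← Equiv.sum_comp (Equiv.addRight y)]
      refine Finset.sum_congr rfl fun h _ => ?_
      rw [sub_eq_add_neg, AddChar.map_add_eq_mul, AddChar.map_neg_eq_inv, Circle.coe_mul,
        Circle.coe_inv_eq_conj]
      rfl
    simp only [this]
    rw [Finset.sum_comm]
    refine Finset.sum_congr rfl fun h _ => ?_
    rw [Finset.mul_sum]
    refine Finset.sum_congr rfl fun y _ => ?_
    rw [hdiff, AddChar.map_add_eq_mul, Circle.coe_mul]
  have hnorm : ‖∑ y, (χ (g y) : ℂ)‖ ^ 2 = ‖((‖∑ y, (χ (g y) : ℂ)‖ ^ 2 : ℝ) : ℂ)‖ := by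
    rw [Complex.norm_real, Real.norm_of_nonneg (by positivity)]
  rw [hnorm, hsq]
  calc _ ≤ ∑ h : Fin m → F, if M.mulVec h = 0 then (Fintype.card F : ℝ) ^ m else 0 := by
        refine (norm_sum_le _ _).trans (Finset.sum_le_sum fun h _ => ?_)
        rw [norm_mul, Circle.norm_coe, one_mul, sum_addChar_dotProduct hχ]
        by_cases hh : M.mulVec h = 0 <;> simp [hh, h2]
    _ = _ := by
        rw [← Finset.sum_filter, Finset.sum_const, card_ker_mulVec, nsmul_eq_mul]
        push_cast
        ring

end QuadraticPhases

theorem sum_norm_sq_le {ι κ : Type*} (A : Finset ι) (W : Finset κ) {c : ι → ℂ}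
    (hc : ∀ a, ‖c a‖ ≤ 1) (g : ι → κ → ℂ) :
    ∑ w ∈ W, ‖∑ a ∈ A, c a * g a w‖ ^ 2 ≤
      ∑ a ∈ A, ∑ a' ∈ A, ‖∑ w ∈ W, g a w * starRingEnd ℂ (g a' w)‖ := by
  have h : ((∑ w ∈ W, ‖∑ a ∈ A, c a * g a w‖ ^ 2 : ℝ) : ℂ) =
      ∑ a ∈ A, ∑ a' ∈ A, c a * starRingEnd ℂ (c a') *
        ∑ w ∈ W, g a w * starRingEnd ℂ (g a' w) := by
    push_cast
    simp only [← Complex.mul_conj', map_sum, map_mul, Finset.sum_mul_sum]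
    rw [Finset.sum_comm]
    refine Finset.sum_congr rfl fun a _ => ?_
    rw [Finset.sum_comm]
    refine Finset.sum_congr rfl fun a' _ => ?_
    rw [Finset.mul_sum]
    exact Finset.sum_congr rfl fun w _ => by ring
  have hnonneg : 0 ≤ ∑ w ∈ W, ‖∑ a ∈ A, c a * g a w‖ ^ 2 :=
    Finset.sum_nonneg fun _ _ => by positivity
  rw [← Real.norm_of_nonneg hnonneg, ← Complex.norm_real, h]
  refine (norm_sum_le _ _).trans <| Finset.sum_le_sum fun a _ =>
    (norm_sum_le _ _).trans <| Finset.sum_le_sum fun a' _ => ?_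
  rw [norm_mul, norm_mul, RCLike.norm_conj]
  exact mul_le_of_le_one_left (norm_nonneg _) (mul_le_one₀ (hc a) (norm_nonneg _) (hc a'))

section Sums

variable {F : Type*} [Field F] [Fintype F]

theorem sum_vaughan {r n : ℕ} (hr : r ≤ n) {Ψ : F[X] → ℂ} (hΨ : Ψ 0 = 0) :
    ∑ f ∈ lowSet F n, (polyMu f : ℂ) * Ψ f =
      (∑ f ∈ lowSet F n, ∑ a ∈ monRange F r n, ∑ b ∈ monRange F r n,
        if a * b ∣ f then (polyMu a : ℂ) * polyMu b * Ψ f else 0) -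
      (∑ f ∈ lowSet F n, ∑ a ∈ monRange F 0 r, ∑ b ∈ monRange F 0 r,
        if a * b ∣ f then (polyMu a : ℂ) * polyMu b * Ψ f else 0) +
      2 * ∑ f ∈ lowSet F n, if f.natDegree < r then (polyMu f : ℂ) * Ψ f else 0 := by
  rw [Finset.mul_sum, ← Finset.sum_sub_distrib, ← Finset.sum_add_distrib]
  refine Finset.sum_congr rfl fun f hf => ?_
  rcases eq_or_ne f 0 with rfl | hf0
  · simp [hΨ]
  · have h := congrArg (fun z : ℤ => (z : ℂ) * Ψ f) (vaughan_identity hr hf hf0)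
    simpa only [Int.cast_add, Int.cast_sub, Int.cast_sum, Int.cast_mul, Int.cast_ite,
      Int.cast_zero, Int.cast_ofNat, add_mul, sub_mul, Finset.sum_mul, ite_mul, zero_mul,
      mul_assoc] using h

theorem norm_sum_natDegree_lt_le {r n : ℕ} {Ψ : F[X] → ℂ} (hΨ : ∀ f, ‖Ψ f‖ ≤ 1) :
    ‖∑ f ∈ lowSet F n, if f.natDegree < r then (polyMu f : ℂ) * Ψ f else 0‖ ≤
      (Fintype.card F : ℝ) ^ r := by
  rw [← Finset.sum_filter]
  have hsub : (lowSet F n).filter (fun f => f.natDegree < r) ⊆ lowSet F r := fun f hf => by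
    rw [mem_lowSet]
    exact degree_le_natDegree.trans_lt (by exact_mod_cast (Finset.mem_filter.1 hf).2)
  have hterm : ∀ f, ‖(polyMu f : ℂ) * Ψ f‖ ≤ 1 := fun f => by
    rw [norm_mul]
    exact mul_le_one₀ (norm_polyMu_le_one f) (norm_nonneg _) (hΨ f)
  calc _ ≤ ∑ f ∈ (lowSet F n).filter (fun f => f.natDegree < r), (1 : ℝ) :=
        (norm_sum_le _ _).trans (Finset.sum_le_sum fun f _ => hterm f)
    _ ≤ (Fintype.card F : ℝ) ^ r := by
        rw [Finset.sum_const, nsmul_eq_mul, mul_one]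
        exact_mod_cast (Finset.card_le_card hsub).trans (card_lowSet r).le

theorem mul_mem_monSet {i j : ℕ} {a b : F[X]} (ha : a ∈ monSet F i) (hb : b ∈ monSet F j) :
    a * b ∈ monSet F (i + j) := by
  obtain ⟨ham, hai⟩ := mem_monSet.1 ha
  obtain ⟨hbm, hbj⟩ := mem_monSet.1 hb
  exact mem_monSet.2 ⟨ham.mul hbm, by rw [ham.natDegree_mul hbm, hai, hbj]⟩

/-- The Type I estimate. -/
theorem norm_typeI_le {r n : ℕ} (hr : 2 * r ≤ n + 2) {Ψ : F[X] → ℂ} {τ : ℝ}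
    (hΨ : ∀ k ≤ 2 * (r - 1), ∀ d ∈ monSet F k, ‖∑ w ∈ lowSet F (n - k), Ψ (d * w)‖ ≤
      (Fintype.card F : ℝ) ^ (n - k) * τ + 1) :
    ‖∑ f ∈ lowSet F n, ∑ a ∈ monRange F 0 r, ∑ b ∈ monRange F 0 r,
        if a * b ∣ f then (polyMu a : ℂ) * polyMu b * Ψ f else 0‖ ≤
      (r : ℝ) ^ 2 * ((Fintype.card F : ℝ) ^ n * τ + (Fintype.card F : ℝ) ^ (2 * r)) := by
  have hq1 : (1 : ℝ) ≤ Fintype.card F := by exact_mod_cast Fintype.card_pos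
  set q : ℝ := (Fintype.card F : ℝ) with hq
  rw [Finset.sum_comm]
  simp only [Finset.sum_comm (s := lowSet F n), sum_monRange]
  have hblock : ∀ i ∈ Finset.Ico 0 r, ∀ j ∈ Finset.Ico 0 r,
      ‖∑ a ∈ monSet F i, ∑ b ∈ monSet F j, ∑ f ∈ lowSet F n,
        if a * b ∣ f then (polyMu a : ℂ) * polyMu b * Ψ f else 0‖ ≤
      q ^ n * τ + q ^ (2 * r) := fun i hi j hj => by
    rw [Finset.mem_Ico] at hi hj
    have hab : ∀ a ∈ monSet F i, ∀ b ∈ monSet F j, ‖∑ f ∈ lowSet F n,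
        if a * b ∣ f then (polyMu a : ℂ) * polyMu b * Ψ f else 0‖ ≤
        q ^ (n - (i + j)) * τ + 1 := fun a ha b hb => by
      have hm := mul_mem_monSet ha hb
      rw [sum_lowSet_of_dvd hm fun f hf => if_neg hf]
      simp only [dvd_mul_right, if_true, ← Finset.mul_sum]
      refine le_trans ?_ (hΨ (i + j) (by omega) _ hm)
      rw [norm_mul, norm_mul]
      exact mul_le_of_le_one_left (norm_nonneg _)
        (mul_le_one₀ (norm_polyMu_le_one a) (norm_nonneg _) (norm_polyMu_le_one b))
    calc _ ≤ ∑ a ∈ monSet F i, ∑ b ∈ monSet F j, (q ^ (n - (i + j)) * τ + 1) :=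
          (norm_sum_le _ _).trans <| Finset.sum_le_sum fun a ha =>
            (norm_sum_le _ _).trans <| Finset.sum_le_sum fun b hb => hab a ha b hb
      _ = q ^ n * τ + q ^ (i + j) := by
          rw [Finset.sum_const, Finset.sum_const, card_monSet, card_monSet, nsmul_eq_mul,
            nsmul_eq_mul]
          push_cast
          rw [← hq, ← pow_sub_mul_pow q (show i + j ≤ n by omega), pow_add q i j]
          ring
      _ ≤ _ := by gcongr; omega
  calc _ = ‖∑ i ∈ Finset.Ico 0 r, ∑ j ∈ Finset.Ico 0 r, ∑ a ∈ monSet F i, ∑ b ∈ monSet F j,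
          ∑ f ∈ lowSet F n, if a * b ∣ f then (polyMu a : ℂ) * polyMu b * Ψ f else 0‖ := by
        congr 1
        exact Finset.sum_congr rfl fun i _ => Finset.sum_comm
    _ ≤ ∑ i ∈ Finset.Ico 0 r, ∑ j ∈ Finset.Ico 0 r, (q ^ n * τ + q ^ (2 * r)) :=
        (norm_sum_le _ _).trans <| Finset.sum_le_sum fun i hi =>
          (norm_sum_le _ _).trans <| Finset.sum_le_sum fun j hj => hblock i hi j hj
    _ = _ := by simp; ring

/-- The coefficients `∑_{b ∣ w} μ(b)`, over monic `b` of degree in `[r, n)`. -/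
noncomputable def truncMuSum (r n : ℕ) (w : F[X]) : ℂ :=
  ∑ b ∈ monRange F r n, if b ∣ w then (polyMu b : ℂ) else 0

theorem norm_truncMuSum_le (r n : ℕ) (w : F[X]) :
    ‖truncMuSum r n w‖ ≤ ((monRange F 0 n).filter (· ∣ w)).card := by
  rw [truncMuSum, ← Finset.sum_filter]
  calc _ ≤ ∑ b ∈ (monRange F r n).filter (· ∣ w), (1 : ℝ) :=
        (norm_sum_le _ _).trans (Finset.sum_le_sum fun b _ => norm_polyMu_le_one b)
    _ ≤ _ := by
        rw [Finset.sum_const, nsmul_eq_mul, mul_one, Nat.cast_le]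
        refine Finset.card_le_card (Finset.filter_subset_filter _ fun b hb => ?_)
        rw [mem_monRange] at hb ⊢
        exact ⟨hb.1, Nat.zero_le _, hb.2.2⟩

/-- The part of the Type II sum in which the first factor has degree `k`. -/
noncomputable def typeIISum (r n : ℕ) (Ψ : F[X] → ℂ) (k : ℕ) : ℂ :=
  ∑ w ∈ (lowSet F (n - k)).erase 0,
    truncMuSum r n w * ∑ a ∈ monSet F k, (polyMu a : ℂ) * Ψ (a * w)

theorem sum_typeII_eq (r n : ℕ) {Ψ : F[X] → ℂ} (hΨ : Ψ 0 = 0) :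
    (∑ f ∈ lowSet F n, ∑ a ∈ monRange F r n, ∑ b ∈ monRange F r n,
        if a * b ∣ f then (polyMu a : ℂ) * polyMu b * Ψ f else 0) =
      ∑ k ∈ Finset.Ico r n, typeIISum r n Ψ k := by
  rw [Finset.sum_comm, sum_monRange]
  refine Finset.sum_congr rfl fun k _ => ?_
  rw [typeIISum]
  simp only [Finset.mul_sum]
  rw [Finset.sum_comm (s := (lowSet F (n - k)).erase 0)]
  refine Finset.sum_congr rfl fun a ha => ?_
  rw [sum_lowSet_of_dvd ha fun f hf => Finset.sum_eq_zero fun b _ =>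
    if_neg fun h => hf ((dvd_mul_right a b).trans h)]
  refine (Finset.sum_erase (a := 0) _ (by simp [hΨ])).symm.trans ?_
  refine Finset.sum_congr rfl fun w _ => ?_
  rw [truncMuSum, Finset.sum_mul]
  refine Finset.sum_congr rfl fun b _ => ?_
  rw [mul_dvd_mul_iff_left (mem_monSet.1 ha).1.ne_zero]
  split_ifs <;> ring

theorem typeIISum_eq_zero {r n k : ℕ} (h : n - k ≤ r) (Ψ : F[X] → ℂ) :
    typeIISum r n Ψ k = 0 := by
  refine Finset.sum_eq_zero fun w hw => ?_
  obtain ⟨hw0, hw⟩ := Finset.mem_erase.1 hw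
  rw [mem_lowSet, degree_eq_natDegree hw0, Nat.cast_lt] at hw
  rw [truncMuSum, Finset.sum_eq_zero, zero_mul]
  refine fun b hb => if_neg fun hbw => ?_
  have := natDegree_le_of_dvd hbw hw0
  have := (mem_monRange.1 hb).2.1
  omega

theorem typeIISum_congr (r n k : ℕ) {Ψ Φ : F[X] → ℂ} (h : ∀ f, f ≠ 0 → Ψ f = Φ f) :
    typeIISum r n Ψ k = typeIISum r n Φ k := by
  refine Finset.sum_congr rfl fun w hw => ?_
  congr 1
  refine Finset.sum_congr rfl fun a ha => ?_
  rw [h _ (mul_ne_zero (mem_monSet.1 ha).1.ne_zero (Finset.ne_of_mem_erase hw))]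

/-- The Type II estimate. -/
theorem norm_sq_typeIISum_le (r n k : ℕ) (Φ : F[X] → ℂ) :
    ‖typeIISum r n Φ k‖ ^ 2 ≤ ((n : ℝ) ^ 3 * (Fintype.card F : ℝ) ^ (n - k)) *
      ∑ a ∈ monSet F k, ∑ a' ∈ monSet F k,
        ‖∑ w ∈ lowSet F (n - k), Φ (a * w) * starRingEnd ℂ (Φ (a' * w))‖ := by
  set W := lowSet F (n - k)
  have hβ : ∑ w ∈ W.erase 0, ‖truncMuSum r n w‖ ^ 2 ≤
      (n : ℝ) ^ 3 * (Fintype.card F : ℝ) ^ (n - k) := by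
    calc _ ≤ ∑ w ∈ W.erase 0, (((monRange F 0 n).filter (· ∣ w)).card : ℝ) ^ 2 :=
          Finset.sum_le_sum fun w _ => by gcongr; exact norm_truncMuSum_le r n w
      _ ≤ ((n - k : ℕ) : ℝ) ^ 3 * (Fintype.card F : ℝ) ^ (n - k) := by
          exact_mod_cast sum_sq_card_divisors_le (F := F) (n - k) n
      _ ≤ _ := by gcongr; omega
  have hG := sum_norm_sq_le (monSet F k) W (fun a => norm_polyMu_le_one a)
    (fun a w => Φ (a * w))
  calc _ ≤ (∑ w ∈ W.erase 0, ‖truncMuSum r n w‖ *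
          ‖∑ a ∈ monSet F k, (polyMu a : ℂ) * Φ (a * w)‖) ^ 2 := by
        gcongr
        refine (norm_sum_le _ _).trans (Finset.sum_le_sum fun w _ => (norm_mul _ _).le)
    _ ≤ (∑ w ∈ W.erase 0, ‖truncMuSum r n w‖ ^ 2) *
          ∑ w ∈ W.erase 0, ‖∑ a ∈ monSet F k, (polyMu a : ℂ) * Φ (a * w)‖ ^ 2 :=
        Finset.sum_mul_sq_le_sq_mul_sq _ _ _
    _ ≤ _ := by
        refine mul_le_mul hβ (le_trans ?_ hG) (Finset.sum_nonneg fun _ _ => by positivity)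
          (by positivity)
        exact Finset.sum_le_sum_of_subset_of_nonneg (Finset.erase_subset _ _)
          fun _ _ _ => by positivity

end Sums

theorem norm_sum_addChar_le_of_rank {F : Type*} [Field F] [Fintype F] (h2 : (2 : F) ≠ 0)
    {χ : AddChar F Circle} (hχ : χ ≠ 1) {m : ℕ} {g : (Fin m → F) → F}
    {M : Matrix (Fin m) (Fin m) F} (hg : HasQuadForm g M) {t : ℝ} (ht : 0 < t)
    (hrank : (1 / t) ^ 2 ≤ (Fintype.card F : ℝ) ^ M.rank) :
    ‖∑ y, (χ (g y) : ℂ)‖ ≤ (Fintype.card F : ℝ) ^ m * t := by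
  have hq0 : 0 < (Fintype.card F : ℝ) := by exact_mod_cast Fintype.card_pos
  refine (sq_le_sq₀ (norm_nonneg _) (by positivity)).1 ?_
  refine (norm_sq_sum_addChar_le h2 hχ hg).trans ?_
  have hr : M.rank ≤ m := by simpa using M.rank_le_width
  rw [mul_pow, sq ((Fintype.card F : ℝ) ^ m), mul_assoc]
  refine mul_le_mul_of_nonneg_left ?_ (by positivity)
  rw [div_pow, one_pow, div_le_iff₀ (by positivity)] at hrank
  calc (Fintype.card F : ℝ) ^ (m - M.rank)
      ≤ (Fintype.card F : ℝ) ^ (m - M.rank) * ((Fintype.card F : ℝ) ^ M.rank * t ^ 2) :=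
        le_mul_of_one_le_right (by positivity) hrank
    _ = _ := by rw [← mul_assoc, pow_sub_mul_pow _ hr]

end

section Dichotomy

variable {F : Type*} [Field F] [Fintype F]

theorem lt_pow_of_logb_lt {x : ℝ} (hx : 0 < x) {r : ℕ}
    (h : Real.logb (Fintype.card F : ℕ) x < r) : x < (Fintype.card F : ℝ) ^ r := by
  rw [Real.logb_lt_iff_lt_rpow (by exact_mod_cast Fintype.one_lt_card) hx,
    Real.rpow_natCast] at h
  exact h

open scoped Classical in
theorem sum_norm_le_of_few_large {ι : Type*} [Fintype ι] {g : ι → ι → ℂ} {S : Set (ι × ι)}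
    {ε Q : ℝ} (hsmall : ∀ a a', (a, a') ∉ S → ‖g a a'‖ ≤ Q * ε)
    (htriv : ∀ a a', ‖g a a'‖ ≤ Q) (hε : 0 ≤ ε) (hQ : 0 ≤ Q)
    (hS : (S.ncard : ℝ) ≤ ε * (Fintype.card ι : ℝ) ^ 2) :
    ∑ a, ∑ a', ‖g a a'‖ ≤ Q * (2 * ε) * (Fintype.card ι : ℝ) ^ 2 := by
  have hterm : ∀ p : ι × ι, ‖g p.1 p.2‖ ≤ Q * ε + if p ∈ S then Q else 0 := fun p => by
    split_ifs with h
    · exact (htriv _ _).trans (le_add_of_nonneg_left (by positivity))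
    · simpa using hsmall _ _ h
  rw [← Fintype.sum_prod_type' fun a a' => ‖g a a'‖]
  refine (Finset.sum_le_sum fun p _ => hterm p).trans ?_
  rw [Finset.sum_add_distrib, ← Finset.sum_filter, Finset.sum_const, Finset.sum_const,
    nsmul_eq_mul, nsmul_eq_mul, Finset.card_univ, Fintype.card_prod]
  have hcard : (Finset.univ.filter (· ∈ S)).card = S.ncard := by
    rw [Set.ncard_eq_toFinset_card', ← Set.filter_mem_univ_eq_toFinset]
  rw [hcard]
  push_cast
  nlinarith [mul_le_mul_of_nonneg_right hS hQ]

theorem add_error_terms_lt {n r Q δ τ E I B II S : ℝ} (hn : 18 ≤ n) (hδ0 : 0 < δ)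
    (hr0 : 0 ≤ r) (hr : 9 * r ≤ n) (hQ : 0 < Q) (hE0 : 0 ≤ E)
    (hE : n ^ 4 * E ^ 2 * 16 ≤ (δ * Q) ^ 2)
    (hτ : τ * (4 * n ^ 2) = δ) (hI : I ≤ r ^ 2 * (Q * τ + E)) (hB : B ≤ E)
    (hII : II * n ^ 2 * 16 ≤ δ * Q) (hS : δ * Q ≤ S) : II + I + 2 * B < S := by
  have hr2 : 81 * r ^ 2 ≤ n ^ 2 := by nlinarith
  have hn2 : 324 ≤ n ^ 2 := by nlinarith
  have hδQ : 0 < δ * Q := by positivity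
  have hE' : n ^ 2 * E * 4 ≤ δ * Q := by
    refine (sq_le_sq₀ (by positivity) hδQ.le).1 (le_trans (le_of_eq ?_) hE)
    ring
  have hτ0 : 0 ≤ τ := by
    by_contra! h
    nlinarith
  have h1 : 324 * (r ^ 2 * (Q * τ)) ≤ δ * Q := by
    rw [← hτ]
    nlinarith [mul_le_mul_of_nonneg_right hr2 (mul_nonneg hQ.le hτ0)]
  have h2 : 324 * (r ^ 2 * E) ≤ δ * Q := by nlinarith [mul_le_mul_of_nonneg_right hr2 hE0]
  have h3 : 324 * E ≤ δ * Q := by nlinarith [mul_le_mul_of_nonneg_right hn2 hE0]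
  have h4 : II * 324 ≤ δ * Q := by
    rcases le_total II 0 with h | h
    · linarith
    · nlinarith [mul_le_mul_of_nonneg_left hn2 h]
  nlinarith

end Dichotomy

/-- If `μ` correlates with the quadratic phase `Φ(f) = χ(P(x(f)))` at level `δ qⁿ`, then
either for some `k ≤ n/9` and some monic `d` of degree `k` the quadratic polynomial
`w ↦ P(x(dw))` has rank at most `log_q(16n⁵/δ²)`, or for some `k ∈ [n/18, 17n/18]`
at least `(δ⁴/(512 n¹⁰)) q^{2k}` pairs `(d,d')` of monic polynomials of degree `k`
are such that `w ↦ P(x(dw)) - P(x(d'w))` has rank at most `2 log_q(512 n¹⁰/δ⁴)`.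
(The rank of a degree-`≤ 2` polynomial is the rank of the unique symmetric matrix `M`
such that the polynomial equals `yᵀMy + bᵀy + c`.) -/
theorem vaughan_rank_dichotomy {F : Type*} [Field F] [Fintype F] (hchar : ringChar F ≠ 2)
    (q : ℕ) (hq : Fintype.card F = q) (n : ℕ) (hn : 18 ≤ n)
    (δ : ℝ) (hδ0 : 0 < δ) (hδ1 : δ ≤ 1)
    (P : MvPolynomial (Fin n) F) (hP : P.totalDegree ≤ 2)
    (χ : AddChar F Circle) (hχ : χ ≠ 1)
    (Phi : Polynomial F → ℂ)
    (hPhi : ∀ f : Polynomial F,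
      Phi f = (χ (MvPolynomial.eval (fun i : Fin n => f.coeff (i : ℕ)) P) : ℂ))
    (hcorr : δ * (q : ℝ) ^ n ≤
      ‖∑ x : Fin n → F, (polyMu (lowPoly F n x) : ℂ) * Phi (lowPoly F n x)‖) :
    (∃ k : ℕ, 9 * k ≤ n ∧ ∃ a : Fin k → F,
      ∃ M : Matrix (Fin (n - k)) (Fin (n - k)) F, Mᵀ = M ∧ ∃ (b : Fin (n - k) → F) (c : F),
        (∀ y : Fin (n - k) → F,
          MvPolynomial.eval
              (fun i : Fin n => (monicPoly F k a * lowPoly F (n - k) y).coeff (i : ℕ)) P =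
            y ⬝ᵥ M.mulVec y + b ⬝ᵥ y + c) ∧
        (M.rank : ℝ) ≤ Real.logb q (16 * (n : ℝ) ^ 5 / δ ^ 2)) ∨
    (∃ k : ℕ, n ≤ 18 * k ∧ 18 * k ≤ 17 * n ∧
      δ ^ 4 / (512 * (n : ℝ) ^ 10) * (q : ℝ) ^ (2 * k) ≤
        ({da : (Fin k → F) × (Fin k → F) |
            ∃ M : Matrix (Fin (n - k)) (Fin (n - k)) F, Mᵀ = M ∧
              ∃ (b : Fin (n - k) → F) (c : F),
                (∀ y : Fin (n - k) → F,
                  MvPolynomial.eval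
                      (fun i : Fin n =>
                        (monicPoly F k da.1 * lowPoly F (n - k) y).coeff (i : ℕ)) P -
                    MvPolynomial.eval
                      (fun i : Fin n =>
                        (monicPoly F k da.2 * lowPoly F (n - k) y).coeff (i : ℕ)) P =
                    y ⬝ᵥ M.mulVec y + b ⬝ᵥ y + c) ∧
                (M.rank : ℝ) ≤ 2 * Real.logb q (512 * (n : ℝ) ^ 10 / δ ^ 4)}.ncard : ℝ)) := by
  classical
  subst hq
  have h2 : (2 : F) ≠ 0 := Ring.two_ne_zero hchar
  by_contra! hcon
  obtain ⟨hI, hII⟩ := hcon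
  have hn0 : (0 : ℝ) < n := by positivity
  have hn18 : (18 : ℝ) ≤ n := by exact_mod_cast hn
  have hqpos : (0 : ℝ) < Fintype.card F := by exact_mod_cast Fintype.card_pos
  have hq1 : (1 : ℝ) ≤ Fintype.card F := by exact_mod_cast Fintype.card_pos
  have hquad := exists_hasQuadForm_mul_lowPoly h2 hP
  have hPhi1 : ∀ f, ‖Phi f‖ ≤ 1 := fun f => by rw [hPhi, Circle.norm_coe]
  have hlarge : ∀ k, 9 * k ≤ n → ∀ (a : Fin k → F) M, HasQuadForm (fun y : Fin (n - k) → F =>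
      MvPolynomial.eval (fun i : Fin n => (monicPoly F k a * lowPoly F (n - k) y).coeff (i : ℕ)) P)
      M → 16 * (n : ℝ) ^ 5 / δ ^ 2 < (Fintype.card F : ℝ) ^ M.rank := fun k hk a M hM => by
    obtain ⟨hMt, b, c, hMq⟩ := hM
    exact lt_pow_of_logb_lt (by positivity) (hI k hk a M hMt b c hMq)
  have hδn : 16 * (n : ℝ) ^ 5 ≤ δ ^ 2 * (Fintype.card F : ℝ) ^ n := by
    obtain ⟨M, hM⟩ := hquad (monicPoly F 0 0) (n - 0)
    have h := hlarge 0 (by omega) 0 M hM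
    rw [div_lt_iff₀ (by positivity)] at h
    refine h.le.trans ?_
    rw [mul_comm]
    gcongr
    simpa using M.rank_le_width
  set τ : ℝ := δ / (4 * (n : ℝ) ^ 2) with hτ
  have hτ0 : 0 < τ := by positivity
  have htypeI : ∀ k, 9 * k ≤ n → ∀ d ∈ monSet F k, ‖∑ w ∈ lowSet F (n - k), Phi (d * w)‖ ≤
      (Fintype.card F : ℝ) ^ (n - k) * τ := fun k hk d hd => by
    obtain ⟨a, -, rfl⟩ := Finset.mem_image.1 hd
    obtain ⟨M, hM⟩ := hquad (monicPoly F k a) (n - k)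
    simp only [sum_lowSet, hPhi]
    refine norm_sum_addChar_le_of_rank h2 hχ hM hτ0 (le_trans ?_ (hlarge k hk a M hM).le)
    rw [hτ, one_div_div, div_pow]
    gcongr
    have : (1 : ℝ) ≤ n := by linarith
    nlinarith [pow_le_pow_right₀ this (show 4 ≤ 5 by norm_num)]
  set ε : ℝ := δ ^ 4 / (512 * (n : ℝ) ^ 10) with hε
  have hε0 : 0 < ε := by positivity
  set r := n / 18 + 1 with hr
  have htypeII : ∀ k ∈ Finset.Ico r n,
      ‖typeIISum r n Phi k‖ * (16 * (n : ℝ) ^ 3) ≤ δ * (Fintype.card F : ℝ) ^ n := fun k hk => by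
    rw [Finset.mem_Ico] at hk
    by_cases hkr : n - k ≤ r
    · rw [typeIISum_eq_zero hkr, norm_zero, zero_mul]
      positivity
    have hfew := hII k (by omega) (by omega)
    have hpairs := sum_norm_le_of_few_large
      (g := fun a a' : Fin k → F => ∑ y : Fin (n - k) → F,
        Phi (monicPoly F k a * lowPoly F (n - k) y) *
          starRingEnd ℂ (Phi (monicPoly F k a' * lowPoly F (n - k) y)))
      (Q := (Fintype.card F : ℝ) ^ (n - k)) (ε := ε) (fun a a' haa => ?_) (fun a a' => ?_)
      hε0.le (by positivity) (hfew.le.trans (le_of_eq ?_))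
    · have hbound := norm_sq_typeIISum_le r n k Phi
      simp only [sum_monSet, sum_lowSet] at hbound
      have hsq := hbound.trans (mul_le_mul_of_nonneg_left hpairs (by positivity))
      have hpow : (Fintype.card F : ℝ) ^ (n - k) * (Fintype.card F : ℝ) ^ k =
          (Fintype.card F : ℝ) ^ n := pow_sub_mul_pow _ hk.2.le
      refine (sq_le_sq₀ (by positivity) (by positivity)).1 ?_
      calc _ = ‖typeIISum r n Phi k‖ ^ 2 * (256 * (n : ℝ) ^ 6) := by ring
        _ ≤ _ := mul_le_mul_of_nonneg_right hsq (by positivity)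
        _ = δ ^ 4 / n * ((Fintype.card F : ℝ) ^ n) ^ 2 := by
          rw [← hpow, hε, Fintype.card_fun, Fintype.card_fin]
          push_cast
          field_simp
          norm_num
        _ ≤ δ ^ 2 * ((Fintype.card F : ℝ) ^ n) ^ 2 := by
          gcongr
          rw [div_le_iff₀ hn0]
          have : δ ^ 2 ≤ 1 := pow_le_one₀ hδ0.le hδ1
          nlinarith [sq_nonneg δ]
        _ = _ := by ring
    · obtain ⟨M, hM⟩ := hquad (monicPoly F k a) (n - k)
      obtain ⟨M', hM'⟩ := hquad (monicPoly F k a') (n - k)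
      have hsub := hM.sub hM'
      have hterm : ∀ y : Fin (n - k) → F, Phi (monicPoly F k a * lowPoly F (n - k) y) *
          starRingEnd ℂ (Phi (monicPoly F k a' * lowPoly F (n - k) y)) =
          (χ (MvPolynomial.eval
              (fun i : Fin n => (monicPoly F k a * lowPoly F (n - k) y).coeff (i : ℕ)) P -
            MvPolynomial.eval
              (fun i : Fin n => (monicPoly F k a' * lowPoly F (n - k) y).coeff (i : ℕ)) P) : ℂ) :=
        fun y => by
          rw [hPhi, hPhi, sub_eq_add_neg, AddChar.map_add_eq_mul, AddChar.map_neg_eq_inv,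
            Circle.coe_mul, Circle.coe_inv_eq_conj]
      simp only [hterm]
      refine norm_sum_addChar_le_of_rank h2 hχ hsub hε0 (le_of_lt (lt_pow_of_logb_lt
        (by positivity) ?_))
      by_contra! hle
      obtain ⟨hNt, b, c, hN⟩ := hsub
      refine haa ⟨_, hNt, b, c, hN, hle.trans (le_of_eq ?_)⟩
      rw [Real.logb_pow, hε, one_div_div]
      norm_num
    · refine (norm_sum_le _ _).trans ((Finset.sum_le_sum fun y _ => ?_).trans
        (le_of_eq (?_ : ∑ y : Fin (n - k) → F, (1 : ℝ) = _)))
      · rw [norm_mul, RCLike.norm_conj]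
        exact mul_le_one₀ (hPhi1 _) (norm_nonneg _) (hPhi1 _)
      · simp
    · rw [Fintype.card_fun, Fintype.card_fin]
      push_cast
      ring
  let Ψ : F[X] → ℂ := fun f => if f = 0 then 0 else Phi f
  have hΨ_zero : Ψ 0 = 0 := if_pos rfl
  have hΨ_ne : ∀ f, f ≠ 0 → Ψ f = Phi f := fun f hf => if_neg hf
  have hΨ1 : ∀ f, ‖Ψ f‖ ≤ 1 := fun f => by
    rcases eq_or_ne f 0 with rfl | hf
    · simp [hΨ_zero]
    · rw [hΨ_ne f hf]; exact hPhi1 f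
  have htypeI' : ∀ k ≤ 2 * (r - 1), ∀ d ∈ monSet F k, ‖∑ w ∈ lowSet F (n - k), Ψ (d * w)‖ ≤
      (Fintype.card F : ℝ) ^ (n - k) * τ + 1 := fun k hk d hd => by
    have hmem : (0 : F[X]) ∈ lowSet F (n - k) := mem_lowSet.2 (by simp)
    have hsplit : ∑ w ∈ lowSet F (n - k), Ψ (d * w) =
        ∑ w ∈ lowSet F (n - k), Phi (d * w) - Phi 0 := by
      rw [← Finset.add_sum_erase _ _ hmem, ← Finset.add_sum_erase _ (fun w => Phi (d * w)) hmem,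
        mul_zero, hΨ_zero, zero_add, add_sub_cancel_left]
      exact Finset.sum_congr rfl fun w hw => hΨ_ne _
        (mul_ne_zero (mem_monSet.1 hd).1.ne_zero (Finset.ne_of_mem_erase hw))
    rw [hsplit]
    exact (norm_sub_le _ _).trans (add_le_add (htypeI k (by omega) d hd) (hPhi1 0))
  have hsum : ∑ x : Fin n → F, (polyMu (lowPoly F n x) : ℂ) * Phi (lowPoly F n x) =
      ∑ f ∈ lowSet F n, (polyMu f : ℂ) * Ψ f := by
    rw [← sum_lowSet n fun f => (polyMu f : ℂ) * Phi f]
    refine Finset.sum_congr rfl fun f _ => ?_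
    rcases eq_or_ne f 0 with rfl | hf
    · simp [polyMu]
    · rw [hΨ_ne f hf]
  have hrn : r ≤ n := by omega
  rw [hsum, sum_vaughan hrn hΨ_zero, sum_typeII_eq r n hΨ_zero,
    Finset.sum_congr rfl fun k _ => typeIISum_congr r n k hΨ_ne] at hcorr
  have hB := norm_sum_natDegree_lt_le (r := r) (n := n) hΨ1
  have hI' := norm_typeI_le (n := n) (r := r) (by omega) htypeI'
  have hII' : ‖∑ k ∈ Finset.Ico r n, typeIISum r n Phi k‖ * (n : ℝ) ^ 2 * 16 ≤
      δ * (Fintype.card F : ℝ) ^ n := by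
    have h := Finset.sum_le_sum htypeII
    rw [← Finset.sum_mul, Finset.sum_const, Nat.card_Ico, nsmul_eq_mul] at h
    have hle : ((n - r : ℕ) : ℝ) * (δ * (Fintype.card F : ℝ) ^ n) ≤
        n * (δ * (Fintype.card F : ℝ) ^ n) := by
      gcongr
      omega
    refine le_of_mul_le_mul_left ?_ hn0
    calc _ = ‖∑ k ∈ Finset.Ico r n, typeIISum r n Phi k‖ * (16 * (n : ℝ) ^ 3) := by ring
      _ ≤ _ := mul_le_mul_of_nonneg_right (norm_sum_le _ _) (by positivity)
      _ ≤ _ := h.trans hle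
  have hlt := add_error_terms_lt (E := (Fintype.card F : ℝ) ^ (2 * r)) (r := (r : ℝ)) hn18 hδ0
    (by positivity) (by exact_mod_cast (by omega : 9 * r ≤ n)) (by positivity) (by positivity)
    ?_ (by rw [hτ]; field_simp) hI' (hB.trans (pow_le_pow_right₀ hq1 (by omega))) hII' hcorr
  · refine absurd hlt (not_lt.2 ((norm_add_le _ _).trans (add_le_add (norm_sub_le _ _) ?_)))
    rw [norm_mul, Complex.norm_two]
  · calc (n : ℝ) ^ 4 * ((Fintype.card F : ℝ) ^ (2 * r)) ^ 2 * 16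
        ≤ (n : ℝ) ^ 5 * (Fintype.card F : ℝ) ^ n * 16 := by
          rw [← pow_mul]
          gcongr
          · linarith
          · norm_num
          · omega
      _ = 16 * (n : ℝ) ^ 5 * (Fintype.card F : ℝ) ^ n := by ring
      _ ≤ δ ^ 2 * (Fintype.card F : ℝ) ^ n * (Fintype.card F : ℝ) ^ n := by gcongr
      _ = _ := by ring
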